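/- arXiv:2501.18015 — 7 statements merged into one kernel-verified Lean document; each statement's English description precedes it below -/
import Mathlib

section
/- Let N < M be positive integers, let d_i = M·K for some positive integer K, and let d_o be a positive integer. Let H ∈ ℝ^{d_i×d_i} be a diagonal matrix with nonnegative diagonal entries and let W* ∈ ℝ^{d_o×d_i} be arbitrary. For each row index i and column index j define the score S_{i,j} = |W*_{i,j}|·H_{j,j}^{1/2}. Let M* ∈ {0,1}^{d_o×d_i} be a mask such that in every row i and every cell of M consecutive columns (k−1)M+1,…,kM, the mask M* equals 1 on N indices with the largest scores S_{i,j} within that cell and 0 on the remaining M−N indices. Then the entrywise product M* ⊙ W* minimizes L(W) = Tr((W − W*) H (W − W*)ᵀ) over all N:M sparse matrices W, i.e., L(M* ⊙ W*) ≤ L(W) for every W ∈ ℝ^{d_o×d_i} such that each row of W has at most N nonzero entries in each cell of M consecutive columns (k−1)M+1,…,kM, k = 1,…,K. -/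
open Finset Matrix

/-- Removing a set `T` of largest elements of `C` leaves a smaller sum than removing any other
set `U` with at most as many elements. -/
theorem sum_sdiff_le_sum_sdiff_of_top {ι : Type*} [DecidableEq ι] {C T U : Finset ι}
    {f : ι → ℝ} (hf : ∀ j, 0 ≤ f j) (hT : T ⊆ C) (hU : U ⊆ C) (hcard : U.card ≤ T.card)
    (htop : ∀ j ∈ T, ∀ j' ∈ C \ T, f j' ≤ f j) :
    ∑ j ∈ C \ T, f j ≤ ∑ j ∈ C \ U, f j := by
  have key : ∑ j ∈ U \ T, f j ≤ ∑ j ∈ T \ U, f j := by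
    rcases (U \ T).eq_empty_or_nonempty with h | h
    · rw [h, sum_empty]
      exact sum_nonneg fun j _ => hf j
    · obtain ⟨m, hm, hmax⟩ := exists_max_image (U \ T) f h
      have hmC : m ∈ C \ T := sdiff_subset_sdiff hU Subset.rfl hm
      have hc : (U \ T).card ≤ (T \ U).card := by
        have h₁ := card_sdiff_add_card_inter U T
        have h₂ := card_sdiff_add_card_inter T U
        rw [inter_comm] at h₂
        omega
      calc ∑ j ∈ U \ T, f j ≤ (U \ T).card • f m := sum_le_card_nsmul _ _ _ hmax
        _ ≤ (T \ U).card • f m := nsmul_le_nsmul_left (hf m) hc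
        _ ≤ ∑ j ∈ T \ U, f j :=
          card_nsmul_le_sum _ _ _ fun j hj => htop j (mem_sdiff.mp hj).1 m hmC
  have h₁ := sum_sdiff (f := f) hT
  have h₂ := sum_sdiff (f := f) hU
  have h₃ := sum_sdiff_sub_sum_sdiff (s₁ := U) (s₂ := T) (f := f)
  linarith

/-- The squared loss of a residual `A` with respect to a diagonal Hessian. -/
theorem trace_mul_mul_transpose_of_diagonal {m n : Type*} [Fintype m] [Fintype n]
    {H : Matrix n n ℝ} (hH : ∀ i j, i ≠ j → H i j = 0) (A : Matrix m n ℝ) :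
    Matrix.trace (A * H * Aᵀ) = ∑ i, ∑ j, A i j ^ 2 * H j j := by
  classical
  have hd : H = diagonal fun j => H j j := by
    ext i j
    by_cases h : i = j
    · subst h
      simp
    · simp [h, hH i j h]
  simp only [Matrix.trace, Matrix.diag_apply]
  refine sum_congr rfl fun i _ => ?_
  rw [Matrix.mul_apply]
  refine sum_congr rfl fun j _ => ?_
  rw [hd, mul_diagonal, transpose_apply, diagonal_apply_eq]
  ring

/-- **WandA is locally optimal for diagonal Hessians.**
Columns are indexed by `Fin (M * K)`; the cell of a column `j` is `j.val / M`. -/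
theorem wanda_opt_diagonal_hessian
    (N M K d_o : ℕ) (hN : 0 < N) (hNM : N < M) (hK : 0 < K) (hdo : 0 < d_o)
    (H : Matrix (Fin (M * K)) (Fin (M * K)) ℝ)
    (hHdiag : ∀ i j, i ≠ j → H i j = 0)
    (hHnn : ∀ j, 0 ≤ H j j)
    (Wstar : Matrix (Fin d_o) (Fin (M * K)) ℝ)
    (S : Fin d_o → Fin (M * K) → ℝ)
    (hS : ∀ i j, S i j = |Wstar i j| * Real.sqrt (H j j))
    (Mask : Matrix (Fin d_o) (Fin (M * K)) ℝ)
    (hMask01 : ∀ i j, Mask i j = 0 ∨ Mask i j = 1)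
    (hMaskTop : ∀ (i : Fin d_o) (k : ℕ), k < K →
      ∃ T : Finset (Fin (M * K)),
        T ⊆ univ.filter (fun j : Fin (M * K) => j.val / M = k) ∧
        T.card = N ∧
        (∀ j ∈ T, Mask i j = 1) ∧
        (∀ j ∈ univ.filter (fun j : Fin (M * K) => j.val / M = k) \ T, Mask i j = 0) ∧
        (∀ j ∈ T, ∀ j' ∈ univ.filter (fun j : Fin (M * K) => j.val / M = k) \ T,
          S i j' ≤ S i j))
    (W : Matrix (Fin d_o) (Fin (M * K)) ℝ)
    (hWsparse : ∀ (i : Fin d_o) (k : ℕ), k < K →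
      (univ.filter (fun j : Fin (M * K) => j.val / M = k ∧ W i j ≠ 0)).card ≤ N) :
    Matrix.trace ((Matrix.of (fun i j => Mask i j * Wstar i j) - Wstar) * H *
        (Matrix.of (fun i j => Mask i j * Wstar i j) - Wstar)ᵀ)
      ≤ Matrix.trace ((W - Wstar) * H * (W - Wstar)ᵀ) := by
  rw [trace_mul_mul_transpose_of_diagonal hHdiag, trace_mul_mul_transpose_of_diagonal hHdiag]
  refine sum_le_sum fun i _ => ?_
  have hcell : ∀ j ∈ (univ : Finset (Fin (M * K))), j.val / M ∈ range K := fun j _ =>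
    mem_range.mpr (Nat.div_lt_of_lt_mul j.isLt)
  rw [← sum_fiberwise_of_maps_to hcell, ← sum_fiberwise_of_maps_to hcell]
  refine sum_le_sum fun k hk => ?_
  obtain ⟨T, hTC, hTcard, hT1, hT0, htop⟩ := hMaskTop i k (mem_range.mp hk)
  have hW := hWsparse i k (mem_range.mp hk)
  rw [← filter_filter] at hW
  set C := univ.filter fun j : Fin (M * K) => j.val / M = k
  have hSsq : ∀ j, S i j ^ 2 = Wstar i j ^ 2 * H j j := fun j => by
    rw [hS, mul_pow, sq_abs, Real.sq_sqrt (hHnn j)]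
  have hSnn : ∀ j, 0 ≤ S i j := fun j => by
    rw [hS]
    positivity
  calc _ = ∑ j ∈ C \ T, S i j ^ 2 := by
        rw [← sum_sdiff hTC, sum_eq_zero (s := T), add_zero]
        · refine sum_congr rfl fun j hj => ?_
          simp [hT0 j hj, hSsq]
        · intro j hj
          simp [hT1 j hj]
    _ ≤ ∑ j ∈ C \ C.filter (fun j => W i j ≠ 0), S i j ^ 2 :=
        sum_sdiff_le_sum_sdiff_of_top (fun j => sq_nonneg _) hTC (filter_subset _ _)
          (hW.trans hTcard.ge)
          fun j hj j' hj' => pow_le_pow_left₀ (hSnn j') (htop j hj j' hj') 2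
    _ = ∑ j ∈ C \ C.filter (fun j => W i j ≠ 0), (W - Wstar) i j ^ 2 * H j j := by
        refine sum_congr rfl fun j hj => ?_
        have hWj : W i j = 0 := by
          by_contra h
          exact (mem_sdiff.mp hj).2 (mem_filter.mpr ⟨(mem_sdiff.mp hj).1, h⟩)
        simp [hWj, hSsq]
    _ ≤ _ := sum_le_sum_of_subset_of_nonneg sdiff_subset fun j _ _ =>
        mul_nonneg (sq_nonneg _) (hHnn j)
end

section
/- Let λ > 0 and z ∈ ℝ⁴ with z_i ≥ 0 for all i. Then every minimizer w* over ℝ⁴ of F_z(w) = (1/2)‖w − z‖² + λ r_{2:4}(w) satisfies w*_i ≥ 0 for all i ∈ {1,2,3,4}. -/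
/-- The 2:4 regularizer `r_{2:4}(w) = |w₁||w₂||w₃| + |w₂||w₃||w₄| + |w₃||w₄||w₁| + |w₄||w₁||w₂|`. -/
noncomputable def r24 (w : Fin 4 → ℝ) : ℝ :=
  |w 0| * |w 1| * |w 2| + |w 1| * |w 2| * |w 3| + |w 2| * |w 3| * |w 0| + |w 3| * |w 0| * |w 1|

/-- The 2:4 proximal objective `F_z(w) = (1/2)‖w − z‖² + λ r_{2:4}(w)`. -/
noncomputable def proxObj (lam : ℝ) (z w : Fin 4 → ℝ) : ℝ :=
  (1 / 2) * (∑ i, (w i - z i) ^ 2) + lam * r24 w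

theorem r24_mono_abs {u w : Fin 4 → ℝ} (h : ∀ i, |u i| ≤ |w i|) : r24 u ≤ r24 w := by
  have h0 := h 0
  have h1 := h 1
  have h2 := h 2
  have h3 := h 3
  unfold r24
  gcongr

/-- **For nonnegative input `z`, every minimizer of the 2:4 proximal objective is nonnegative.** -/
theorem prox_minimizer_nonneg (lam : ℝ) (hlam : 0 < lam) (z : Fin 4 → ℝ)
    (hz : ∀ i, 0 ≤ z i)
    (wstar : Fin 4 → ℝ) (hmin : ∀ u : Fin 4 → ℝ, proxObj lam z wstar ≤ proxObj lam z u) :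
    ∀ i, 0 ≤ wstar i := by
  intro i
  by_contra! hi
  have habs : ∀ j, |Function.update wstar i 0 j| ≤ |wstar j| := by
    intro j
    rcases eq_or_ne j i with rfl | hj
    · simp
    · simp [hj]
  have hlt : (Function.update wstar i 0 i - z i) ^ 2 < (wstar i - z i) ^ 2 := by
    rw [Function.update_self]
    nlinarith [mul_nonneg (neg_nonneg.mpr hi.le) (hz i), mul_pos_of_neg_of_neg hi hi]
  have hsum : ∑ j, (Function.update wstar i 0 j - z j) ^ 2 < ∑ j, (wstar j - z j) ^ 2 := by
    refine Finset.sum_lt_sum (fun j _ => ?_) ⟨i, Finset.mem_univ i, hlt⟩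
    rcases eq_or_ne j i with rfl | hj
    · exact hlt.le
    · simp [hj]
  have hreg := mul_le_mul_of_nonneg_left (r24_mono_abs habs) hlam.le
  have hle := hmin (Function.update wstar i 0)
  unfold proxObj at hle
  linarith
end

section
/- Let λ > 0 and z ∈ ℝ⁴ with z₁ ≥ z₂ ≥ z₃ ≥ z₄ ≥ 0. Then there exists a minimizer w* of f(w) = (1/2)‖w − z‖² + λ(w₁w₂w₃ + w₂w₃w₄ + w₃w₄w₁ + w₄w₁w₂) over the nonnegative orthant ℝ₊⁴ = {w ∈ ℝ⁴ : w_i ≥ 0} satisfying w*₁ ≥ w*₂ ≥ w*₃ ≥ w*₄ ≥ 0. Moreover, if w is any minimizer of f over ℝ₊⁴ and w_i < w_j for some indices i < j, then the vector obtained from w by swapping coordinates i and j is also a minimizer of f over ℝ₊⁴. -/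
/-- The smooth 2:4 objective on the nonnegative orthant:
`f(w) = (1/2)‖w − z‖² + λ(w₁w₂w₃ + w₂w₃w₄ + w₃w₄w₁ + w₄w₁w₂)`. -/
noncomputable def fObj (lam : ℝ) (z w : Fin 4 → ℝ) : ℝ :=
  (1 / 2) * (∑ i, (w i - z i) ^ 2) +
    lam * (w 0 * w 1 * w 2 + w 1 * w 2 * w 3 + w 2 * w 3 * w 0 + w 3 * w 0 * w 1)

theorem sum_prod_erase_comp_perm {ι R : Type*} [Fintype ι] [DecidableEq ι] [CommSemiring R]
    (w : ι → R) (σ : Equiv.Perm ι) :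
    ∑ i, ∏ j ∈ Finset.univ.erase i, (w ∘ σ) j = ∑ i, ∏ j ∈ Finset.univ.erase i, w j := by
  rw [← Equiv.sum_comp σ (fun i => ∏ j ∈ Finset.univ.erase i, w j)]
  exact Finset.sum_congr rfl fun i _ => Finset.prod_equiv σ (by simp) (by simp)

theorem fObj_eq_sum_prod_erase (lam : ℝ) (z w : Fin 4 → ℝ) :
    fObj lam z w =
      (1 / 2) * (∑ i, (w i - z i) ^ 2) + lam * ∑ i, ∏ j ∈ Finset.univ.erase i, w j := by
  have h0 : (Finset.univ.erase 0 : Finset (Fin 4)) = {1, 2, 3} := by decide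
  have h1 : (Finset.univ.erase 1 : Finset (Fin 4)) = {0, 2, 3} := by decide
  have h2 : (Finset.univ.erase 2 : Finset (Fin 4)) = {0, 1, 3} := by decide
  have h3 : (Finset.univ.erase 3 : Finset (Fin 4)) = {0, 1, 2} := by decide
  simp only [fObj, Fin.sum_univ_four, h0, h1, h2, h3]
  congr 2
  simp
  ring

/-- Permuting the coordinates changes the objective only through the pairing with `z`. -/
theorem fObj_comp_perm_le (lam : ℝ) (z w : Fin 4 → ℝ) (σ : Equiv.Perm (Fin 4))
    (h : ∑ i, w i * z i ≤ ∑ i, (w ∘ σ) i * z i) :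
    fObj lam z (w ∘ σ) ≤ fObj lam z w := by
  have hexp (v : Fin 4 → ℝ) :
      ∑ i, (v i - z i) ^ 2 = ∑ i, v i ^ 2 - 2 * ∑ i, v i * z i + ∑ i, z i ^ 2 := by
    simp only [Fin.sum_univ_four]
    ring
  have hsq : ∑ i, (w ∘ σ) i ^ 2 = ∑ i, w i ^ 2 := Equiv.sum_comp σ (fun i => w i ^ 2)
  rw [fObj_eq_sum_prod_erase, fObj_eq_sum_prod_erase, sum_prod_erase_comp_perm, hexp, hexp, hsq]
  linarith

theorem sum_mul_le_sum_comp_swap_mul {ι : Type*} [Fintype ι] [DecidableEq ι] (z w : ι → ℝ)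
    {i j : ι} (hij : i ≠ j) (hz : z j ≤ z i) (hw : w i ≤ w j) :
    ∑ k, w k * z k ≤ ∑ k, (w ∘ Equiv.swap i j) k * z k := by
  rw [← sub_nonneg, ← Finset.sum_sub_distrib,
    Fintype.sum_eq_add i j hij fun k hk => by simp [Equiv.swap_apply_of_ne_of_ne hk.1 hk.2]]
  simp only [Function.comp_apply, Equiv.swap_apply_left, Equiv.swap_apply_right]
  nlinarith [mul_nonneg (sub_nonneg.2 hz) (sub_nonneg.2 hw)]

/-- Truncating a nonnegative vector at `z` does not increase the objective. -/
theorem fObj_inf_le {lam : ℝ} (hlam : 0 ≤ lam) {z u : Fin 4 → ℝ} (hz : 0 ≤ z) (hu : 0 ≤ u) :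
    fObj lam z (u ⊓ z) ≤ fObj lam z u := by
  have hnn : 0 ≤ u ⊓ z := le_inf hu hz
  rw [fObj_eq_sum_prod_erase, fObj_eq_sum_prod_erase]
  gcongr (1 / 2) * ∑ i, ?_ + lam * ∑ i, ∏ j ∈ _, ?_ with i
  · rcases le_total (u i) (z i) with h | h
    · simp [h]
    · simp [h]
  · exact fun j _ => hnn j
  · exact inf_le_left

theorem exists_fObj_minimizer {lam : ℝ} (hlam : 0 ≤ lam) {z : Fin 4 → ℝ} (hz : 0 ≤ z) :
    ∃ w : Fin 4 → ℝ, 0 ≤ w ∧ ∀ u : Fin 4 → ℝ, 0 ≤ u → fObj lam z w ≤ fObj lam z u := by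
  have hcont : Continuous (fObj lam z) := by
    unfold fObj
    fun_prop
  obtain ⟨w, hw, hmin⟩ :=
    (isCompact_Icc (a := 0) (b := z)).exists_isMinOn ⟨0, le_rfl, hz⟩ hcont.continuousOn
  exact ⟨w, hw.1, fun u hu =>
    (hmin ⟨le_inf hu hz, inf_le_right⟩).trans (fObj_inf_le hlam hz hu)⟩

/-- **Sorted inputs admit sorted minimizers.** For `z₁ ≥ z₂ ≥ z₃ ≥ z₄ ≥ 0` there exists a
minimizer of `f` over `ℝ₊⁴` which is sorted in descending order; moreover swapping any two
out-of-order coordinates of a minimizer yields again a minimizer. -/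
theorem sorted_minimizer_exists (lam : ℝ) (hlam : 0 < lam) (z : Fin 4 → ℝ)
    (hz : z 0 ≥ z 1 ∧ z 1 ≥ z 2 ∧ z 2 ≥ z 3 ∧ z 3 ≥ 0) :
    (∃ w : Fin 4 → ℝ, (∀ i, 0 ≤ w i) ∧
        (∀ u : Fin 4 → ℝ, (∀ i, 0 ≤ u i) → fObj lam z w ≤ fObj lam z u) ∧
        w 0 ≥ w 1 ∧ w 1 ≥ w 2 ∧ w 2 ≥ w 3 ∧ w 3 ≥ 0) ∧
    (∀ w : Fin 4 → ℝ, (∀ i, 0 ≤ w i) →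
        (∀ u : Fin 4 → ℝ, (∀ i, 0 ≤ u i) → fObj lam z w ≤ fObj lam z u) →
        ∀ i j : Fin 4, i < j → w i < w j →
          (∀ k, 0 ≤ (w ∘ Equiv.swap i j) k) ∧
          (∀ u : Fin 4 → ℝ, (∀ k, 0 ≤ u k) →
            fObj lam z (w ∘ Equiv.swap i j) ≤ fObj lam z u)) := by
  obtain ⟨h01, h12, h23, h3⟩ := hz
  have hanti : Antitone z := by
    rw [Fin.antitone_iff_succ_le]
    intro i
    fin_cases i
    exacts [h01, h12, h23]
  have hnn : 0 ≤ z := fun i => h3.trans (hanti (Fin.le_last i))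
  refine ⟨?_, fun w hw hmin i j hij hwij => ⟨fun k => hw _, fun u hu => ?_⟩⟩
  · obtain ⟨w, hw, hmin⟩ := exists_fObj_minimizer hlam.le hnn
    have hsort : Antitone (w ∘ Tuple.sort (-w)) := fun i j hij =>
      neg_le_neg_iff.1 (Tuple.monotone_sort (-w) hij)
    have hle : ∑ i, w i * z i ≤ ∑ i, (w ∘ Tuple.sort (-w)) i * z i := by
      simpa using (hsort.monovary hanti).sum_comp_perm_mul_le_sum_mul (σ := (Tuple.sort (-w))⁻¹)
    exact ⟨w ∘ Tuple.sort (-w), fun i => hw _,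
      fun u hu => (fObj_comp_perm_le lam z w _ hle).trans (hmin u hu),
      hsort (by decide), hsort (by decide), hsort (by decide), hw _⟩
  · exact (fObj_comp_perm_le lam z w _
      (sum_mul_le_sum_comp_swap_mul z w hij.ne (hanti hij.le) hwij.le)).trans (hmin u hu)
end

section
/- Let λ > 0 and z ∈ ℝ⁴ with z₁ ≥ z₂ ≥ z₃ ≥ z₄ > 0, and let w* be a minimizer of f(w) = (1/2)‖w − z‖² + λ(w₁w₂w₃ + w₂w₃w₄ + w₃w₄w₁ + w₄w₁w₂) over ℝ₊⁴ with w*₁ ≥ w*₂ ≥ w*₃ ≥ w*₄ ≥ 0. Then w* falls into one of the following three cases: (i) 2-sparse: w* = (z₁, z₂, 0, 0); (ii) 3-sparse: w*₄ = 0 and w*₁, w*₂, w*₃ > 0 with w*₁ = z₁ − λ w*₂ w*₃, w*₂ = z₂ − λ w*₁ w*₃, and w*₃ = z₃ − λ w*₁ w*₂; (iii) dense: w*_i > 0 for all i and for every i ∈ {1,2,3,4}, w*_i = z_i − λ Σ_{{j₁,j₂} ⊆ {1,2,3,4}\{i}, j₁ ≠ j₂} w*_{j₁} w*_{j₂}.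 -/
/-- A half-line minimizer `a` of `x ↦ (x - a)² / 2 + (x - a) g` over `x ≥ 0` has nonnegative
slope `g`, and `g` vanishes when `a` is interior. -/
theorem nonneg_slope_and_interior_stationary {a g : ℝ}
    (h : ∀ x, 0 ≤ x → 0 ≤ (x - a) ^ 2 / 2 + (x - a) * g) (ha : 0 ≤ a) :
    0 ≤ g ∧ (0 < a → g = 0) := by
  have hg : 0 ≤ g := by
    by_contra! hneg
    nlinarith [h (a - g) (by linarith)]
  refine ⟨hg, fun hpos => ?_⟩
  by_contra hne
  have hgpos : 0 < g := lt_of_le_of_ne hg (Ne.symm hne)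
  have ht : 0 < min a g := lt_min hpos hgpos
  nlinarith [h (a - min a g) (by linarith [min_le_left a g]), min_le_right a g]

/-- **Optimality conditions (Lemma: three cases).** For `z₁ ≥ z₂ ≥ z₃ ≥ z₄ > 0`, any sorted
minimizer of `f` over `ℝ₊⁴` is 2-sparse, 3-sparse, or dense, with the stated stationarity
equations. -/
theorem minimizer_three_cases (lam : ℝ) (hlam : 0 < lam) (z : Fin 4 → ℝ)
    (hz : z 0 ≥ z 1 ∧ z 1 ≥ z 2 ∧ z 2 ≥ z 3 ∧ z 3 > 0)
    (w : Fin 4 → ℝ) (hwnn : ∀ i, 0 ≤ w i)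
    (hsorted : w 0 ≥ w 1 ∧ w 1 ≥ w 2 ∧ w 2 ≥ w 3 ∧ w 3 ≥ 0)
    (hmin : ∀ u : Fin 4 → ℝ, (∀ i, 0 ≤ u i) → fObj lam z w ≤ fObj lam z u) :
    (w = ![z 0, z 1, 0, 0]) ∨
    (w 3 = 0 ∧ 0 < w 0 ∧ 0 < w 1 ∧ 0 < w 2 ∧
      w 0 = z 0 - lam * (w 1 * w 2) ∧
      w 1 = z 1 - lam * (w 0 * w 2) ∧
      w 2 = z 2 - lam * (w 0 * w 1)) ∨
    ((∀ i, 0 < w i) ∧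
      w 0 = z 0 - lam * (w 1 * w 2 + w 1 * w 3 + w 2 * w 3) ∧
      w 1 = z 1 - lam * (w 0 * w 2 + w 0 * w 3 + w 2 * w 3) ∧
      w 2 = z 2 - lam * (w 0 * w 1 + w 0 * w 3 + w 1 * w 3) ∧
      w 3 = z 3 - lam * (w 0 * w 1 + w 0 * w 2 + w 1 * w 2)) := by
  obtain ⟨h01, h12, h23, h3⟩ := hz
  have coord := fun i x hx => hmin (Function.update w i x) fun j => by
    by_cases hj : j = i
    · subst hj
      simpa using (hx : (0 : ℝ) ≤ x)
    · simpa [hj] using hwnn j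
  obtain ⟨g0, s0⟩ := nonneg_slope_and_interior_stationary (a := w 0)
    (g := w 0 - z 0 + lam * (w 1 * w 2 + w 1 * w 3 + w 2 * w 3))
    (fun x hx => by
      have := coord 0 x hx
      simp [fObj, Fin.sum_univ_four, Function.update] at this
      linarith) (hwnn 0)
  obtain ⟨g1, s1⟩ := nonneg_slope_and_interior_stationary (a := w 1)
    (g := w 1 - z 1 + lam * (w 0 * w 2 + w 0 * w 3 + w 2 * w 3))
    (fun x hx => by
      have := coord 1 x hx
      simp [fObj, Fin.sum_univ_four, Function.update] at this
      linarith) (hwnn 1)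
  obtain ⟨-, s2⟩ := nonneg_slope_and_interior_stationary (a := w 2)
    (g := w 2 - z 2 + lam * (w 0 * w 1 + w 0 * w 3 + w 1 * w 3))
    (fun x hx => by
      have := coord 2 x hx
      simp [fObj, Fin.sum_univ_four, Function.update] at this
      linarith) (hwnn 2)
  obtain ⟨-, s3⟩ := nonneg_slope_and_interior_stationary (a := w 3)
    (g := w 3 - z 3 + lam * (w 0 * w 1 + w 0 * w 2 + w 1 * w 2))
    (fun x hx => by
      have := coord 3 x hx
      simp [fObj, Fin.sum_univ_four, Function.update] at this
      linarith) (hwnn 3)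
  obtain ⟨k01, k12, k23, -⟩ := hsorted
  rcases (hwnn 3).eq_or_lt with e3 | p3
  · rcases (hwnn 2).eq_or_lt with e2 | p2
    · left
      simp only [← e2, ← e3, mul_zero, add_zero] at g0 g1 s0 s1
      have r0 := s0 (by linarith)
      have r1 := s1 (by linarith)
      ext i
      fin_cases i <;> simp <;> linarith
    · right; left
      have p1 : 0 < w 1 := by linarith
      have p0 : 0 < w 0 := by linarith
      simp only [← e3, mul_zero, add_zero] at s0 s1 s2
      exact ⟨e3.symm, p0, p1, p2, by linarith [s0 p0], by linarith [s1 p1],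
        by linarith [s2 p2]⟩
  · right; right
    have p2 : 0 < w 2 := by linarith
    have p1 : 0 < w 1 := by linarith
    have p0 : 0 < w 0 := by linarith
    refine ⟨fun i => ?_, by linarith [s0 p0], by linarith [s1 p1], by linarith [s2 p2],
      by linarith [s3 p3]⟩
    fin_cases i <;> assumption
end

section
/- Let λ > 0 and z ∈ ℝ⁴ with z₁ ≥ z₂ ≥ z₃ ≥ z₄ > 0. If w* = (z₁, z₂, 0, 0) is a minimizer of f(w) = (1/2)‖w − z‖² + λ(w₁w₂w₃ + w₂w₃w₄ + w₃w₄w₁ + w₄w₁w₂) over the nonnegative orthant ℝ₊⁴, then λ ≥ z₃/(z₁ z₂). -/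
/-- **Necessary condition for the 2-sparse regime:** if `(z₁, z₂, 0, 0)` minimizes `f` over
`ℝ₊⁴`, then `λ ≥ z₃ / (z₁ z₂)`. -/
theorem two_sparse_necessary_condition (lam : ℝ) (hlam : 0 < lam) (z : Fin 4 → ℝ)
    (hz : z 0 ≥ z 1 ∧ z 1 ≥ z 2 ∧ z 2 ≥ z 3 ∧ z 3 > 0)
    (hmin : ∀ u : Fin 4 → ℝ, (∀ i, 0 ≤ u i) →
      fObj lam z ![z 0, z 1, 0, 0] ≤ fObj lam z u) :
    lam ≥ z 2 / (z 0 * z 1) := by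
  obtain ⟨h01, h12, h23, h3⟩ := hz
  have h2 : 0 < z 2 := by linarith
  have h1 : 0 < z 1 := by linarith
  have h0 : 0 < z 0 := by linarith
  rw [ge_iff_le, div_le_iff₀ (mul_pos h0 h1)]
  by_contra! hlt
  have ht : 0 < z 2 - lam * (z 0 * z 1) := sub_pos.mpr hlt
  have hle := hmin ![z 0, z 1, z 2 - lam * (z 0 * z 1), 0] (by
    intro i
    fin_cases i
    · exact h0.le
    · exact h1.le
    · exact ht.le
    · exact le_rfl)
  simp [fObj, Fin.sum_univ_four] at hle
  nlinarith [mul_pos ht ht]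
end

section
/- Let λ > 0 and z ∈ ℝ⁴ with z₁ ≥ z₂ ≥ z₃ ≥ z₄ > 0. If w* is a minimizer of f(w) = (1/2)‖w − z‖² + λ(w₁w₂w₃ + w₂w₃w₄ + w₃w₄w₁ + w₄w₁w₂) over the nonnegative orthant ℝ₊⁴ with w*₄ = 0 and w*₁, w*₂, w*₃ > 0, then λ ≥ z₄/(w*₁ w*₂ + w*₂ w*₃ + w*₁ w*₃); in particular, the weaker inequality λ ≥ z₄/(z₁ z₂ + z₂ z₃ + z₁ z₃) holds. -/
/-- A minimizer of `fObj` over the nonnegative orthant lies coordinatewise below `z`. -/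
theorem le_of_fObj_minimizer {lam : ℝ} (hlam : 0 < lam) {z w : Fin 4 → ℝ}
    (hz : ∀ i, 0 ≤ z i) (hwnn : ∀ i, 0 ≤ w i)
    (hmin : ∀ u : Fin 4 → ℝ, (∀ i, 0 ≤ u i) → fObj lam z w ≤ fObj lam z u) (i : Fin 4) :
    w i ≤ z i := by
  by_contra! h
  have hle : ∀ j, Function.update w i (z i) j ≤ w j := by
    intro j
    rcases eq_or_ne j i with rfl | hj
    · simpa using h.le
    · simp [hj]
  have hnn : ∀ j, 0 ≤ Function.update w i (z i) j := by
    intro j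
    rcases eq_or_ne j i with rfl | hj
    · simpa using hz j
    · simpa [hj] using hwnn j
  have hsum : ∑ j, (Function.update w i (z i) j - z j) ^ 2 < ∑ j, (w j - z j) ^ 2 := by
    refine Finset.sum_lt_sum (fun j _ => ?_) ⟨i, Finset.mem_univ i, ?_⟩
    · rcases eq_or_ne j i with rfl | hj
      · simpa using sq_nonneg (w j - z j)
      · simp [hj]
    · simpa using pow_pos (sub_pos.2 h) 2
  have hmul : ∀ a b c, Function.update w i (z i) a * Function.update w i (z i) b *
      Function.update w i (z i) c ≤ w a * w b * w c := fun a b c =>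
    mul_le_mul (mul_le_mul (hle a) (hle b) (hnn b) (hwnn a)) (hle c) (hnn c)
      (mul_nonneg (hwnn a) (hwnn b))
  have hcubic := mul_le_mul_of_nonneg_left
    (add_le_add (add_le_add (add_le_add (hmul 0 1 2) (hmul 1 2 3)) (hmul 2 3 0)) (hmul 3 0 1))
    hlam.le
  have := hmin _ hnn
  unfold fObj at this
  linarith

/-- **Necessary condition for the 3-sparse regime:** if a minimizer of `f` over `ℝ₊⁴` has
`w*₄ = 0` and `w*₁, w*₂, w*₃ > 0`, then `λ ≥ z₄ / (w*₁w*₂ + w*₂w*₃ + w*₁w*₃)`, and in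
particular `λ ≥ z₄ / (z₁z₂ + z₂z₃ + z₁z₃)`. -/
theorem three_sparse_necessary_condition (lam : ℝ) (hlam : 0 < lam) (z : Fin 4 → ℝ)
    (hz : z 0 ≥ z 1 ∧ z 1 ≥ z 2 ∧ z 2 ≥ z 3 ∧ z 3 > 0)
    (w : Fin 4 → ℝ) (hwnn : ∀ i, 0 ≤ w i)
    (hmin : ∀ u : Fin 4 → ℝ, (∀ i, 0 ≤ u i) → fObj lam z w ≤ fObj lam z u)
    (hw3 : w 3 = 0) (hw0 : 0 < w 0) (hw1 : 0 < w 1) (hw2 : 0 < w 2) :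
    lam ≥ z 3 / (w 0 * w 1 + w 1 * w 2 + w 0 * w 2) ∧
    lam ≥ z 3 / (z 0 * z 1 + z 1 * z 2 + z 0 * z 2) := by
  obtain ⟨h01, h12, h23, hz3⟩ := hz
  have hle := le_of_fObj_minimizer hlam
    (fun i => by fin_cases i <;> simp <;> linarith) hwnn hmin
  have hS : 0 < w 0 * w 1 + w 1 * w 2 + w 0 * w 2 := by positivity
  have key : z 3 ≤ lam * (w 0 * w 1 + w 1 * w 2 + w 0 * w 2) := by
    by_contra! h
    have ht := sub_pos.2 h
    have := hmin ![w 0, w 1, w 2, z 3 - lam * (w 0 * w 1 + w 1 * w 2 + w 0 * w 2)]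
      (fun i => by fin_cases i <;> simp <;> linarith)
    simp only [fObj, Fin.sum_univ_four, hw3, Matrix.cons_val] at this
    nlinarith [pow_pos ht 2]
  have hmono : w 0 * w 1 + w 1 * w 2 + w 0 * w 2 ≤ z 0 * z 1 + z 1 * z 2 + z 0 * z 2 := by
    have := hle 0
    have := hle 1
    have := hle 2
    gcongr <;> linarith
  refine ⟨(div_le_iff₀ hS).2 key, (div_le_iff₀ (hS.trans_le hmono)).2 (key.trans ?_)⟩
  gcongr
end

section
/- Let λ > 0 and z ∈ ℝ⁴ with z_i ≥ 0 for all i, and let w* be a minimizer of f(w) = (1/2)‖w − z‖² + λ(w₁w₂w₃ + w₂w₃w₄ + w₃w₄w₁ + w₄w₁w₂) over the nonnegative orthant ℝ₊⁴. Then w*_i ≤ z_i for all i, and if r(w*) := w*₁w*₂w*₃ + w*₂w*₃w*₄ + w*₃w*₄w*₁ + w*₄w*₁w*₂ ≠ 0, then λ = (zᵀw* − ‖w*‖²)/(3 r(w*)). -/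
/-- The regularizer `r(w) = w₁w₂w₃ + w₂w₃w₄ + w₃w₄w₁ + w₄w₁w₂` (for nonnegative `w`). -/
noncomputable def rPos (w : Fin 4 → ℝ) : ℝ :=
  w 0 * w 1 * w 2 + w 1 * w 2 * w 3 + w 2 * w 3 * w 0 + w 3 * w 0 * w 1

/-- `f` splits into its quadratic part and the regularizer. -/
theorem fObj_eq (lam : ℝ) (z w : Fin 4 → ℝ) :
    fObj lam z w = (1 / 2) * (∑ i, (w i - z i) ^ 2) + lam * rPos w := rfl

/-- The regularizer is monotone on the nonnegative orthant. -/
theorem rPos_mono {u w : Fin 4 → ℝ} (hu : ∀ i, 0 ≤ u i) (h : ∀ i, u i ≤ w i) :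
    rPos u ≤ rPos w := by
  have hw i : 0 ≤ w i := (hu i).trans (h i)
  have key i j k : u i * u j * u k ≤ w i * w j * w k :=
    mul_le_mul (mul_le_mul (h i) (h j) (hu j) (hw i)) (h k) (hu k)
      (mul_nonneg (hw i) (hw j))
  unfold rPos
  linarith [key 0 1 2, key 1 2 3, key 2 3 0, key 3 0 1]

/-- The objective along the ray through `w` is a cubic polynomial in the scale. -/
theorem fObj_smul (lam s : ℝ) (z w : Fin 4 → ℝ) :
    fObj lam z (s • w) =
      (1 / 2) * (∑ i, w i ^ 2) * s ^ 2 - (∑ i, z i * w i) * s + (1 / 2) * (∑ i, z i ^ 2) +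
        lam * rPos w * s ^ 3 := by
  simp only [fObj, rPos, Fin.sum_univ_four, Pi.smul_apply, smul_eq_mul]
  ring

/-- A minimizer over the nonnegative orthant is dominated by `z`. -/
theorem minimizer_le {lam : ℝ} (hlam : 0 ≤ lam) {z w : Fin 4 → ℝ}
    (hz : ∀ i, 0 ≤ z i) (hw : ∀ i, 0 ≤ w i)
    (hmin : ∀ u : Fin 4 → ℝ, (∀ i, 0 ≤ u i) → fObj lam z w ≤ fObj lam z u) (i : Fin 4) :
    w i ≤ z i := by
  by_contra! hi
  have hu j : 0 ≤ min (w j) (z j) := le_min (hw j) (hz j)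
  have hf := hmin (fun j => min (w j) (z j)) hu
  have hr := mul_le_mul_of_nonneg_left (rPos_mono hu fun j => min_le_left (w j) (z j)) hlam
  have hs : ∑ j, (min (w j) (z j) - z j) ^ 2 < ∑ j, (w j - z j) ^ 2 := by
    refine Finset.sum_lt_sum (fun j _ => ?_) ⟨i, Finset.mem_univ i, ?_⟩
    · rcases le_total (w j) (z j) with h | h
      · rw [min_eq_left h]
      · simpa [min_eq_right h] using sq_nonneg (w j - z j)
    · simpa [min_eq_right hi.le] using pow_pos (sub_pos.2 hi) 2
  rw [fObj_eq, fObj_eq] at hf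
  linarith

/-- Stationarity of the objective along the ray through a minimizer. -/
theorem minimizer_radial_stationary {lam : ℝ} {z w : Fin 4 → ℝ} (hw : ∀ i, 0 ≤ w i)
    (hmin : ∀ u : Fin 4 → ℝ, (∀ i, 0 ≤ u i) → fObj lam z w ≤ fObj lam z u) :
    ∑ i, w i ^ 2 - ∑ i, z i * w i + 3 * lam * rPos w = 0 := by
  have hloc : IsLocalMin (fun s : ℝ => fObj lam z (s • w)) 1 := by
    filter_upwards [lt_mem_nhds (zero_lt_one : (0 : ℝ) < 1)] with s hs
    simpa only [one_smul] using hmin (s • w) fun i => mul_nonneg hs.le (hw i)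
  simp only [fObj_smul] at hloc
  have hderiv := (((((hasDerivAt_pow 2 (1 : ℝ)).const_mul ((1 / 2) * ∑ i, w i ^ 2)).sub
    ((hasDerivAt_id (1 : ℝ)).const_mul (∑ i, z i * w i))).add_const
    ((1 / 2) * ∑ i, z i ^ 2)).add ((hasDerivAt_pow 3 (1 : ℝ)).const_mul (lam * rPos w)))
  have h := hloc.hasDerivAt_eq_zero hderiv
  norm_num at h
  linarith

/-- **KKT consequences:** any minimizer `w*` of `f` over `ℝ₊⁴` satisfies `w*ᵢ ≤ zᵢ` for all
`i`, and if `r(w*) ≠ 0` then `λ = (zᵀw* − ‖w*‖²) / (3 r(w*))`. -/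
theorem minimizer_dominated_and_lambda_formula (lam : ℝ) (hlam : 0 < lam) (z : Fin 4 → ℝ)
    (hz : ∀ i, 0 ≤ z i)
    (wstar : Fin 4 → ℝ) (hwnn : ∀ i, 0 ≤ wstar i)
    (hmin : ∀ u : Fin 4 → ℝ, (∀ i, 0 ≤ u i) → fObj lam z wstar ≤ fObj lam z u) :
    (∀ i, wstar i ≤ z i) ∧
    (rPos wstar ≠ 0 →
      lam = ((∑ i, z i * wstar i) - ∑ i, (wstar i) ^ 2) / (3 * rPos wstar)) := by
  refine ⟨minimizer_le hlam.le hz hwnn hmin, fun hr => ?_⟩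
  have h := minimizer_radial_stationary hwnn hmin
  rw [eq_div_iff (mul_ne_zero three_ne_zero hr)]
  linarith
end
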